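/- arXiv:1709.10416 — 4 statements merged into one kernel-verified Lean document; each statement's English description precedes it below -/
import Mathlib

section
/- Let k be an algebraically closed field of characteristic p > 0, let K = k((t)) be the field of formal Laurent series over k, and let L/K be a separable field extension of degree p. Then there exist a uniformizer x of K (i.e. an element of K with ord(x) = 1), an element y of the integral closure O_L of k[[t]] in L with v_L(y) = 1, and an integer n with n > p and gcd(n, p) = 1, such that y^p + y^n = x holds in L. -/
/-- A finite module over an adically precomplete ring is precomplete. -/
theorem IsPrecomplete.of_moduleFinite {R M : Type*} [CommRing R] [AddCommGroup M] [Module R M]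
    [Module.Finite R M] (I : Ideal R) [IsPrecomplete I R] : IsPrecomplete I M := by
  rw [← AdicCompletion.of_surjective_iff]
  intro a
  obtain ⟨b, rfl⟩ := AdicCompletion.ofTensorProduct_surjective_of_finite I M a
  induction b using TensorProduct.induction_on with
  | zero => exact ⟨0, by simp⟩
  | tmul r m =>
    obtain ⟨s, rfl⟩ := AdicCompletion.of_surjective I R r
    refine ⟨s • m, ?_⟩
    rw [AdicCompletion.ofTensorProduct_tmul, map_smul]
    exact (algebraMap_smul (AdicCompletion I R) s (AdicCompletion.of I M m)).symm
  | add x y hx hy =>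
    obtain ⟨a, ha⟩ := hx
    obtain ⟨b, hb⟩ := hy
    exact ⟨a + b, by rw [map_add, map_add, ha, hb]⟩

/-- Precompleteness in terms of sequences with small consecutive differences. -/
theorem IsPrecomplete.exists_limit {R M : Type*} [CommRing R] [AddCommGroup M] [Module R M]
    (I : Ideal R) [h : IsPrecomplete I M] (f : ℕ → M)
    (hf : ∀ n, f (n + 1) - f n ∈ (I ^ n • ⊤ : Submodule R M)) :
    ∃ a, ∀ n, a - f n ∈ (I ^ n • ⊤ : Submodule R M) := by
  obtain ⟨a, ha⟩ := h.prec (f := f) (by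
    intro m n hmn
    induction n, hmn using Nat.le_induction with
    | base => rfl
    | succ n hmn ih =>
      refine ih.trans (SModEq.symm ?_)
      rw [SModEq.sub_mem]
      exact Submodule.smul_mono_left (Ideal.pow_le_pow_right hmn) (hf n))
  exact ⟨a, fun n => SModEq.sub_mem.1 (ha n).symm⟩

/-- Dependent choice along `ℕ`, with a property of each term and a relation between
consecutive terms. -/
theorem exists_seq_of_step {α : Type*} (P : ℕ → α → Prop) (Q : ℕ → α → α → Prop)
    (h0 : ∃ a, P 0 a) (hs : ∀ n a, P n a → ∃ b, P (n + 1) b ∧ Q n a b) :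
    ∃ f : ℕ → α, ∀ n, P n (f n) ∧ Q n (f n) (f (n + 1)) := by
  obtain ⟨a, ha⟩ := h0
  choose! g hg using hs
  let f : ℕ → α := fun n => Nat.rec a g n
  have hP : ∀ n, P n (f n) := by
    intro n
    induction n with
    | zero => exact ha
    | succ n ih => exact (hg n _ ih).1
  exact ⟨f, fun n => ⟨hP n, (hg n _ (hP n)).2⟩⟩

namespace AddValuation

variable {L : Type*} [Field L] (v : AddValuation L (WithTop ℤ))

/-- The additive subgroup of elements of valuation at least `n`. -/
def geSubgroup (n : ℕ) : AddSubgroup L where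
  carrier := {r | ((n : ℤ) : WithTop ℤ) ≤ v r}
  zero_mem' := by simp
  add_mem' ha hb := v.map_le_add ha hb
  neg_mem' ha := by simpa using ha

variable {v}

theorem mem_geSubgroup {n : ℕ} {r : L} :
    r ∈ v.geSubgroup n ↔ ((n : ℤ) : WithTop ℤ) ≤ v r := Iff.rfl

theorem mem_geSubgroup_zero {r : L} : r ∈ v.geSubgroup 0 ↔ 0 ≤ v r := by
  simp [mem_geSubgroup]

theorem geSubgroup_mono {m n : ℕ} (h : m ≤ n) {r : L} (hr : r ∈ v.geSubgroup n) :
    r ∈ v.geSubgroup m :=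
  le_trans (by exact_mod_cast h) (mem_geSubgroup.1 hr)

theorem mul_mem_geSubgroup {m n : ℕ} {r s : L} (hr : r ∈ v.geSubgroup m)
    (hs : s ∈ v.geSubgroup n) : r * s ∈ v.geSubgroup (m + n) := by
  rw [mem_geSubgroup, map_mul]
  push_cast
  exact add_le_add hr hs

theorem pow_mem_geSubgroup {m : ℕ} {r : L} (hr : r ∈ v.geSubgroup m) (i : ℕ) :
    r ^ i ∈ v.geSubgroup (m * i) := by
  induction i with
  | zero => simp [mem_geSubgroup]
  | succ i ih => rw [pow_succ, mul_add_one]; exact mul_mem_geSubgroup ih hr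

theorem map_pow_eq {m : ℕ} {r : L} (hr : v r = ((m : ℤ) : WithTop ℤ)) (i : ℕ) :
    v (r ^ i) = (((m * i : ℕ) : ℤ) : WithTop ℤ) := by
  induction i with
  | zero => simp
  | succ i ih => rw [pow_succ, map_mul, ih, hr, mul_add_one]; push_cast; rfl

theorem exists_mul_pow {z : L} (hz : v z = 1) {n : ℕ} {r : L} (hr : r ∈ v.geSubgroup n) :
    ∃ s ∈ v.geSubgroup 0, r = s * z ^ n := by
  have hz0 : z ≠ 0 := by rintro rfl; simp at hz
  have h : v (z ^ n) = ((n : ℤ) : WithTop ℤ) := by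
    simpa using map_pow_eq (v := v) (r := z) (m := 1) (by simpa using hz) n
  refine ⟨r / z ^ n, ?_, by field_simp⟩
  have h2 : v r = v (r / z ^ n) + v (z ^ n) := by rw [← map_mul]; congr 1; field_simp
  rw [mem_geSubgroup, h2, h] at hr
  rw [mem_geSubgroup]
  cases hq : v (r / z ^ n) with
  | top => simp
  | coe q => rw [hq] at hr; norm_cast at hr ⊢; omega

theorem eq_zero_of_forall_mem {r : L} (h : ∀ n, r ∈ v.geSubgroup n) : r = 0 := by
  rw [← v.top_iff]
  cases hq : v r with
  | top => rfl
  | coe q =>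
    have := h (q.toNat + 1)
    rw [mem_geSubgroup, hq] at this
    norm_cast at this
    omega

theorem mem_of_pow_mem {r : L} {q i : ℕ} (hq : 0 < q) (h : r ^ q ∈ v.geSubgroup (i * q)) :
    r ∈ v.geSubgroup i := by
  rw [mem_geSubgroup] at *
  rw [map_pow] at h
  cases hr : v r with
  | top => simp
  | coe s =>
    rw [hr, ← WithTop.coe_nsmul] at h
    norm_cast at h ⊢
    push_cast at h
    rw [nsmul_eq_mul] at h
    have : (0 : ℤ) < q := by exact_mod_cast hq
    nlinarith

theorem eq_coe_of_mem_of_notMem {r : L} {n : ℕ} (h : r ∈ v.geSubgroup n)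
    (h' : r ∉ v.geSubgroup (n + 1)) : v r = ((n : ℤ) : WithTop ℤ) := by
  rw [mem_geSubgroup] at h h'
  cases hr : v r with
  | top => simp [hr] at h'
  | coe s =>
    rw [hr] at h h'
    norm_cast at *
    push_cast at *
    omega

theorem map_eq_of_sub_mem {x y : L} {n : ℕ} (hx : v x = ((n : ℤ) : WithTop ℤ))
    (h : y - x ∈ v.geSubgroup (n + 1)) : v y = ((n : ℤ) : WithTop ℤ) := by
  rw [← hx]
  apply v.map_eq_of_lt_sub
  refine lt_of_lt_of_le ?_ h
  rw [hx]
  norm_cast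
  omega

theorem notMem_of_map_eq {x : L} {n m : ℕ} (hx : v x = ((n : ℤ) : WithTop ℤ)) (h : n < m) :
    x ∉ v.geSubgroup m := by
  rw [mem_geSubgroup, hx]
  norm_cast
  omega

theorem pow_sub_pow_mem {a b : L} {q m : ℕ} (ha : a ∈ v.geSubgroup q) (hb : b ∈ v.geSubgroup q)
    (hab : a - b ∈ v.geSubgroup m) (j : ℕ) :
    a ^ (j + 1) - b ^ (j + 1) ∈ v.geSubgroup (m + q * j) := by
  induction j with
  | zero => simpa using hab
  | succ j ih =>
    have : a ^ (j + 1 + 1) - b ^ (j + 1 + 1) =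
        (a ^ (j + 1) - b ^ (j + 1)) * a + (a - b) * b ^ (j + 1) := by ring
    rw [this]
    exact add_mem (by simpa [mul_add_one, add_assoc] using mul_mem_geSubgroup ih ha)
      (mul_mem_geSubgroup hab (pow_mem_geSubgroup hb _))

theorem add_pow_sub_linear_mem {z w : L} {i : ℕ} (hz : z ∈ v.geSubgroup 1)
    (hw : w ∈ v.geSubgroup (i + 1)) (m : ℕ) :
    (z + w) ^ (m + 1) - z ^ (m + 1) - (m + 1 : ℕ) * w * z ^ m ∈
      v.geSubgroup (2 * i + 1 + m) := by
  induction m with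
  | zero => simp
  | succ m ih =>
    have : (z + w) ^ (m + 1 + 1) - z ^ (m + 1 + 1) - (m + 1 + 1 : ℕ) * w * z ^ (m + 1) =
        ((z + w) ^ (m + 1) - z ^ (m + 1) - (m + 1 : ℕ) * w * z ^ m) * (z + w) +
          (m + 1) • (w * w * z ^ m) := by
      push_cast [nsmul_eq_mul]; ring
    rw [this]
    have hzw : z + w ∈ v.geSubgroup 1 := add_mem hz (geSubgroup_mono (by omega) hw)
    rw [← add_assoc]
    refine add_mem (mul_mem_geSubgroup ih hzw) ?_
    refine nsmul_mem (geSubgroup_mono ?_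
      (mul_mem_geSubgroup (mul_mem_geSubgroup hw hw) (pow_mem_geSubgroup hz m))) _
    omega

variable {k : Type*} [Field k]

theorem exists_leadingCoeff {φ : k →+* L}
    (hres : ∀ r ∈ v.geSubgroup 0, ∃ c, r - φ c ∈ v.geSubgroup 1) {z : L} (hz : v z = 1) {n : ℕ}
    {r : L} (hr : r ∈ v.geSubgroup n) : ∃ c, r - φ c * z ^ n ∈ v.geSubgroup (n + 1) := by
  obtain ⟨s, hs, rfl⟩ := exists_mul_pow hz hr
  obtain ⟨c, hc⟩ := hres s hs
  refine ⟨c, ?_⟩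
  rw [← sub_mul, add_comm n 1]
  have hz1 : z ∈ v.geSubgroup 1 := by simp [mem_geSubgroup, hz]
  simpa using mul_mem_geSubgroup hc (pow_mem_geSubgroup hz1 n)

/-- Expansion to finite order in powers of a uniformizer. -/
theorem exists_sum_sub_mem {φ : k →+* L}
    (hres : ∀ r ∈ v.geSubgroup 0, ∃ c, r - φ c ∈ v.geSubgroup 1) {z : L} (hz : v z = 1)
    {r : L} (hr : r ∈ v.geSubgroup 0) (n : ℕ) :
    ∃ c : ℕ → k, r - ∑ i ∈ Finset.range n, φ (c i) * z ^ i ∈ v.geSubgroup n := by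
  induction n with
  | zero => exact ⟨0, by simpa using hr⟩
  | succ n ih =>
    obtain ⟨c, hc⟩ := ih
    obtain ⟨d, hd⟩ := exists_leadingCoeff hres hz hc
    refine ⟨fun i => if i = n then d else c i, ?_⟩
    beta_reduce
    rw [Finset.sum_range_succ, ← sub_sub, if_pos rfl]
    convert hd using 3
    refine Finset.sum_congr rfl fun i hi => ?_
    rw [if_neg (Finset.mem_range.1 hi).ne]

theorem map_add_eq_one {z w : L} (hz : v z = 1) (hw : w ∈ v.geSubgroup 2) : v (z + w) = 1 := by
  simpa using map_eq_of_sub_mem (v := v) (x := z) (y := z + w) (n := 1) (by simpa using hz)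
    (by simpa using hw)

/-- If `x` is a `p`-th power up to an error whose order is divisible by `p`, the error can be
improved. -/
theorem exists_improve_pow {φ : k →+* L} [IsAlgClosed k] {p : ℕ} [Fact p.Prime] [CharP L p]
    (hφ : ∀ c, φ c ∈ v.geSubgroup 0)
    (hres : ∀ r ∈ v.geSubgroup 0, ∃ c, r - φ c ∈ v.geSubgroup 1) {x z : L} (hz : v z = 1)
    {j : ℕ} (hj : 2 ≤ j) (h : x - z ^ p ∈ v.geSubgroup (j * p)) :
    ∃ z', v z' = 1 ∧ x - z' ^ p ∈ v.geSubgroup (j * p + 1) := by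
  obtain ⟨c, hc⟩ := exists_leadingCoeff hres hz h
  obtain ⟨d, rfl⟩ := IsAlgClosed.exists_pow_nat_eq c (Fact.out : p.Prime).pos
  have hz1 : z ∈ v.geSubgroup 1 := by simp [mem_geSubgroup, hz]
  refine ⟨z + φ d * z ^ j, map_add_eq_one hz (geSubgroup_mono hj ?_), ?_⟩
  · simpa using mul_mem_geSubgroup (hφ d) (pow_mem_geSubgroup hz1 j)
  · rw [add_pow_char, mul_pow, ← pow_mul, ← sub_sub, ← _root_.map_pow]
    exact hc

/-- Increasing the precision of an approximate equation `x = z ^ p + z ^ n` by a simultaneous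
change of `x` and `z`. -/
theorem exists_improve_pow_add_pow {φ : k →+* L} {p : ℕ} [Fact p.Prime] [CharP L p]
    (hφ : ∀ c, φ c ∈ v.geSubgroup 0)
    (hres : ∀ r ∈ v.geSubgroup 0, ∃ c, r - φ c ∈ v.geSubgroup 1) {x z : L} (hz : v z = 1)
    {m i : ℕ} (hm : ((m + 1 : ℕ) : k) ≠ 0) (hpm : p < m + 1) (hi : 1 ≤ i)
    (h : x - z ^ p - z ^ (m + 1) ∈ v.geSubgroup (m + 1 + i)) :
    ∃ a : k, (x + φ a ^ p * x ^ (i + 1)) - (z + φ a * z ^ (i + 1)) ^ p -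
      (z + φ a * z ^ (i + 1)) ^ (m + 1) ∈ v.geSubgroup (m + 1 + (i + 1)) := by
  have hp := (Fact.out : p.Prime).two_le
  obtain ⟨c, hc⟩ := exists_leadingCoeff hres hz h
  obtain ⟨a, rfl⟩ : ∃ a, c = (m + 1 : ℕ) * a := ⟨c / (m + 1 : ℕ), by field_simp⟩
  have hz1 : z ∈ v.geSubgroup 1 := by simp [mem_geSubgroup, hz]
  have hzn (j : ℕ) : z ^ j ∈ v.geSubgroup j := by simpa using pow_mem_geSubgroup hz1 j
  have hxz : x - z ^ p ∈ v.geSubgroup (m + 1) := by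
    have := add_mem (geSubgroup_mono (by omega) h) (hzn (m + 1))
    simpa using this
  have hx : x ∈ v.geSubgroup p := by
    have := add_mem (geSubgroup_mono (by omega) hxz) (hzn p)
    simpa using this
  have h1 := mul_mem_geSubgroup (pow_mem_geSubgroup (hφ a) p)
    (pow_sub_pow_mem hx (hzn p) hxz i)
  have hw := mul_mem_geSubgroup (hφ a) (hzn (i + 1))
  rw [zero_add] at hw
  have h2 := add_pow_sub_linear_mem hz1 hw m
  refine ⟨a, ?_⟩
  have key : (x + φ a ^ p * x ^ (i + 1)) - (z + φ a * z ^ (i + 1)) ^ p -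
      (z + φ a * z ^ (i + 1)) ^ (m + 1) =
      (x - z ^ p - z ^ (m + 1) - φ ((m + 1 : ℕ) * a) * z ^ (m + 1 + i)) +
        φ a ^ p * (x ^ (i + 1) - (z ^ p) ^ (i + 1)) -
        ((z + φ a * z ^ (i + 1)) ^ (m + 1) - z ^ (m + 1) -
          (m + 1 : ℕ) * (φ a * z ^ (i + 1)) * z ^ m) := by
    rw [add_pow_char, _root_.map_mul, map_natCast]
    ring
  rw [key]
  have : i ≤ p * i - i := by
    have := Nat.mul_le_mul_right i hp
    omega
  exact sub_mem (add_mem hc (geSubgroup_mono (by omega) h1)) (geSubgroup_mono (by omega) h2)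

theorem map_const_eq_zero {φ : k →+* L} (hφ : ∀ c, φ c ∈ v.geSubgroup 0) {c : k} (hc : c ≠ 0) :
    v (φ c) = 0 := by
  have h1 := mem_geSubgroup_zero.1 (hφ c)
  have h2 := mem_geSubgroup_zero.1 (hφ c⁻¹)
  have h3 : v (φ c) + v (φ c⁻¹) = 0 := by
    rw [← map_mul, ← _root_.map_mul, mul_inv_cancel₀ hc, _root_.map_one, map_one]
  refine le_antisymm ?_ h1
  calc v (φ c) ≤ v (φ c) + v (φ c⁻¹) := le_add_of_nonneg_right h2
    _ = 0 := h3

/-- An element of valuation `p` that is not arbitrarily well approximated by `p`-th powers is, up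
to rescaling, of the form `z ^ p + z ^ n + ⋯` with `n` prime to `p`. -/
theorem exists_pow_add_pow_approx {φ : k →+* L} [IsAlgClosed k] {p : ℕ} [Fact p.Prime]
    [CharP L p] (hφ : ∀ c, φ c ∈ v.geSubgroup 0)
    (hres : ∀ r ∈ v.geSubgroup 0, ∃ c, r - φ c ∈ v.geSubgroup 1) (hv1 : ∃ π : L, v π = 1)
    {x : L} (hx : v x = ((p : ℤ) : WithTop ℤ))
    (hno : ¬ ∀ N, ∃ z, v z = 1 ∧ x - z ^ p ∈ v.geSubgroup N) :
    ∃ (c : k) (z : L) (n : ℕ), v z = 1 ∧ p < n ∧ ¬ p ∣ n ∧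
      φ c * x - z ^ p - z ^ n ∈ v.geSubgroup (n + 1) := by
  classical
  have hp := (Fact.out : p.Prime).pos
  obtain ⟨π, hπ⟩ := hv1
  have hbase : ∃ z, v z = 1 ∧ x - z ^ p ∈ v.geSubgroup (p + 1) := by
    obtain ⟨c, hc⟩ := exists_leadingCoeff hres hπ (mem_geSubgroup.2 hx.ge)
    obtain ⟨d, rfl⟩ := IsAlgClosed.exists_pow_nat_eq c hp
    have hd : d ≠ 0 := by
      rintro rfl
      rw [zero_pow hp.ne', _root_.map_zero, zero_mul, sub_zero] at hc
      exact notMem_of_map_eq hx (Nat.lt_succ_self p) hc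
    refine ⟨φ d * π, by rw [map_mul, map_const_eq_zero hφ hd, hπ, zero_add], ?_⟩
    rwa [mul_pow, ← _root_.map_pow]
  push Not at hno
  let N := Nat.find hno
  have hN : ∀ z, v z = 1 → x - z ^ p ∉ v.geSubgroup N := Nat.find_spec hno
  have hmin : ∀ m < N, ∃ z, v z = 1 ∧ x - z ^ p ∈ v.geSubgroup m := by
    intro m hm
    have := Nat.find_min hno hm
    push Not at this
    exact this
  have hpN : p + 1 < N := by
    by_contra! hle
    obtain ⟨z, hz, hzx⟩ := hbase
    exact hN z hz (geSubgroup_mono hle hzx)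
  obtain ⟨n, hn⟩ : ∃ n, N = n + 1 := ⟨N - 1, by omega⟩
  rw [hn] at hN hmin hpN
  obtain ⟨z, hz, hzx⟩ := hmin n (Nat.lt_succ_self n)
  have hpn : ¬ p ∣ n := by
    rintro ⟨j, rfl⟩
    rw [mul_comm p j] at hzx hN
    have hj : 2 ≤ j := by
      by_contra! hj
      have : p * j ≤ p * 1 := Nat.mul_le_mul_left p (by omega)
      omega
    obtain ⟨z', hz', h'⟩ := exists_improve_pow hφ hres hz hj hzx
    exact hN z' hz' h'
  obtain ⟨c, hc⟩ := exists_leadingCoeff hres hz hzx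
  have hc0 : c ≠ 0 := by
    rintro rfl
    rw [_root_.map_zero, zero_mul, sub_zero] at hc
    exact hN z hz hc
  obtain ⟨l, rfl⟩ := IsAlgClosed.exists_pow_nat_eq c (n := n - p) (by omega)
  have hl : l ≠ 0 := by
    rintro rfl
    exact hc0 (zero_pow (by omega))
  refine ⟨l ^ p, φ l * z, n, by rw [map_mul, map_const_eq_zero hφ hl, hz, zero_add], by omega,
    hpn, ?_⟩
  have hnp : φ l ^ n = φ l ^ p * φ l ^ (n - p) := by rw [← pow_add]; congr 1; omega
  have key : φ (l ^ p) * x - (φ l * z) ^ p - (φ l * z) ^ n =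
      φ (l ^ p) * (x - z ^ p - φ (l ^ (n - p)) * z ^ n) := by
    rw [mul_pow, mul_pow, hnp, _root_.map_pow, _root_.map_pow]; ring
  rw [key]
  simpa using mul_mem_geSubgroup (hφ (l ^ p)) hc

end AddValuation

namespace PowerSeries

open AddValuation

variable {k L : Type*} [Field k] [Field L] [Algebra k⟦X⟧ L] {v : AddValuation L (WithTop ℤ)}

theorem algebraMap_mem_geSubgroup_of_mem_span_pow (hv : ∀ f : k⟦X⟧, 0 ≤ v (algebraMap k⟦X⟧ L f))
    (hX : algebraMap k⟦X⟧ L X ∈ v.geSubgroup 1) {f : k⟦X⟧} {i : ℕ}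
    (hf : f ∈ Ideal.span {(X : k⟦X⟧)} ^ i) : algebraMap k⟦X⟧ L f ∈ v.geSubgroup i := by
  rw [Ideal.span_singleton_pow, Ideal.mem_span_singleton] at hf
  obtain ⟨g, rfl⟩ := hf
  rw [_root_.map_mul, _root_.map_pow]
  simpa using mul_mem_geSubgroup (pow_mem_geSubgroup hX i) (mem_geSubgroup_zero.2 (hv g))

theorem map_algebraMap_of_isUnit (hv : ∀ f : k⟦X⟧, 0 ≤ v (algebraMap k⟦X⟧ L f)) {f : k⟦X⟧}
    (hf : IsUnit f) : v (algebraMap k⟦X⟧ L f) = 0 := by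
  obtain ⟨g, hg⟩ := hf.exists_right_inv
  have h : v (algebraMap k⟦X⟧ L f) + v (algebraMap k⟦X⟧ L g) = 0 := by
    rw [← AddValuation.map_mul, ← _root_.map_mul, hg, _root_.map_one, AddValuation.map_one]
  refine le_antisymm ?_ (hv f)
  calc _ ≤ v (algebraMap k⟦X⟧ L f) + v (algebraMap k⟦X⟧ L g) := le_add_of_nonneg_right (hv g)
    _ = 0 := h

theorem exists_map_algebraMap_eq (hv : ∀ f : k⟦X⟧, 0 ≤ v (algebraMap k⟦X⟧ L f)) {e : ℕ}
    (he : v (algebraMap k⟦X⟧ L X) = ((e : ℤ) : WithTop ℤ)) {f : k⟦X⟧} (hf : f ≠ 0) :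
    ∃ (m : ℕ) (u : k⟦X⟧ˣ), f = (u : k⟦X⟧) * X ^ m ∧
      v (algebraMap k⟦X⟧ L f) = (((e * m : ℕ) : ℤ) : WithTop ℤ) := by
  obtain ⟨m, u, rfl⟩ := IsDiscreteValuationRing.eq_unit_mul_pow_irreducible hf X_irreducible
  refine ⟨m, u, rfl, ?_⟩
  rw [_root_.map_mul, AddValuation.map_mul, map_algebraMap_of_isUnit hv u.isUnit, zero_add,
    _root_.map_pow, map_pow_eq he]

theorem order_coe_unit_mul_X (u : k⟦X⟧ˣ) :
    HahnSeries.order ((((u : k⟦X⟧) * X : k⟦X⟧) : LaurentSeries k)) = 1 := by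
  have h1 : (((u : k⟦X⟧) * X : k⟦X⟧) : LaurentSeries k).coeff 1 ≠ 0 := by
    rw [coeff_coe]
    simpa using (isUnit_iff_constantCoeff.1 u.isUnit).ne_zero
  apply le_antisymm (HahnSeries.order_le_of_coeff_ne_zero h1)
  rw [HahnSeries.le_order_iff_forall (by intro h; simp [h] at h1)]
  intro j hj
  rw [coeff_coe]
  split_ifs with h0
  · rfl
  · obtain rfl : j = 0 := by omega
    simp

/-- Solving `y ^ p + y ^ n = x` by successive approximation, starting from an approximate
solution. -/
theorem exists_pow_add_pow_eq {p n : ℕ} [Fact p.Prime] [CharP L p]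
    (hv : ∀ f : k⟦X⟧, 0 ≤ v (algebraMap k⟦X⟧ L f))
    (hX : algebraMap k⟦X⟧ L X ∈ v.geSubgroup 1)
    (hres : ∀ r ∈ v.geSubgroup 0, ∃ c, r - (algebraMap k⟦X⟧ L).comp C c ∈ v.geSubgroup 1)
    (hlim : ∀ f : ℕ → L, (∀ i, 0 ≤ v (f i)) → (∀ i, f (i + 1) - f i ∈ v.geSubgroup i) →
      ∃ a, ∀ i, a - f i ∈ v.geSubgroup i)
    (hpn : p < n) (hn : (n : k) ≠ 0) {x : k⟦X⟧} {z : L} (hz : v z = 1)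
    (h : algebraMap k⟦X⟧ L x - z ^ p - z ^ n ∈ v.geSubgroup (n + 1)) :
    ∃ (x : k⟦X⟧) (y : L), v y = 1 ∧ y ^ p + y ^ n = algebraMap k⟦X⟧ L x := by
  obtain ⟨m, rfl⟩ : ∃ m, n = m + 1 := ⟨n - 1, by omega⟩
  have hp := (Fact.out : p.Prime).pos
  have hφ : ∀ c, (algebraMap k⟦X⟧ L).comp C c ∈ v.geSubgroup 0 :=
    fun c => mem_geSubgroup_zero.2 (hv _)
  have one_mem {z : L} (hz : v z = 1) : z ∈ v.geSubgroup 1 := by simp [mem_geSubgroup, hz]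
  obtain ⟨f, hf⟩ := exists_seq_of_step
    (fun i (q : k⟦X⟧ × L) => v q.2 = 1 ∧
      algebraMap k⟦X⟧ L q.1 - q.2 ^ p - q.2 ^ (m + 1) ∈ v.geSubgroup (m + 1 + (i + 1)))
    (fun i q q' => q'.1 - q.1 ∈ Ideal.span {(X : k⟦X⟧)} ^ i ∧ q'.2 - q.2 ∈ v.geSubgroup i)
    ⟨(x, z), hz, h⟩ (by
      rintro i ⟨x, z⟩ ⟨hz, h⟩
      dsimp only at hz h
      obtain ⟨a, ha⟩ := exists_improve_pow_add_pow hφ hres hz hn hpn (Nat.succ_pos i) h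
      have hzi : z ^ (i + 1 + 1) ∈ v.geSubgroup (i + 2) := by
        simpa using pow_mem_geSubgroup (one_mem hz) (i + 2)
      have hazi := mul_mem_geSubgroup (hφ a) hzi
      rw [zero_add] at hazi
      refine ⟨(x + C a ^ p * x ^ (i + 1 + 1),
        z + (algebraMap k⟦X⟧ L).comp C a * z ^ (i + 1 + 1)), ⟨?_, ?_⟩, ?_, ?_⟩
      · exact map_add_eq_one hz (geSubgroup_mono (by omega) hazi)
      · simpa using ha
      · have hx : x ∈ Ideal.span {(X : k⟦X⟧)} := by
          rw [Ideal.mem_span_singleton, X_dvd_iff]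
          by_contra hx0
          have hu := map_algebraMap_of_isUnit hv (isUnit_iff_constantCoeff.2 (Ne.isUnit hx0))
          refine notMem_of_map_eq (m := 1) (n := 0) (by simpa using hu) one_pos ?_
          have h1 : z ^ p ∈ v.geSubgroup 1 :=
            geSubgroup_mono (by omega) (pow_mem_geSubgroup (one_mem hz) p)
          have h2 : z ^ (m + 1) ∈ v.geSubgroup 1 :=
            geSubgroup_mono (by omega) (pow_mem_geSubgroup (one_mem hz) (m + 1))
          have := add_mem (add_mem (geSubgroup_mono (by omega) h) h2) h1
          simpa using this
        simp only [add_sub_cancel_left]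
        exact Ideal.mul_mem_left _ _
          (Ideal.pow_le_pow_right (by omega) (Ideal.pow_mem_pow hx (i + 1 + 1)))
      · simpa using geSubgroup_mono (by omega) hazi)
  obtain ⟨y, hy⟩ := hlim (fun i => (f i).2) (fun i => by rw [(hf i).1.1]; exact zero_le_one)
    (fun i => (hf i).2.2)
  obtain ⟨x, hx⟩ := IsPrecomplete.exists_limit (Ideal.span {(X : k⟦X⟧)}) (fun i => (f i).1)
    (fun i => by simpa using (hf i).2.1)
  have hy1 : v y = 1 := by
    simpa using map_add_eq_one (hf 2).1.1 (hy 2)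
  refine ⟨x, y, hy1, ?_⟩
  rw [eq_comm, ← sub_eq_zero, ← sub_sub]
  refine eq_zero_of_forall_mem (v := v) fun i => ?_
  obtain ⟨⟨hzi, hxi⟩, -⟩ := hf i
  have hxi' : algebraMap k⟦X⟧ L (x - (f i).1) ∈ v.geSubgroup i :=
    algebraMap_mem_geSubgroup_of_mem_span_pow hv hX (by simpa using hx i)
  have hpow (j : ℕ) : y ^ (j + 1) - (f i).2 ^ (j + 1) ∈ v.geSubgroup i :=
    geSubgroup_mono (Nat.le_add_right _ _) (pow_sub_pow_mem (one_mem hy1) (one_mem hzi) (hy i) j)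
  have h1 := hpow (p - 1)
  rw [Nat.sub_add_cancel hp] at h1
  have key : algebraMap k⟦X⟧ L x - y ^ p - y ^ (m + 1) =
      (algebraMap k⟦X⟧ L (f i).1 - (f i).2 ^ p - (f i).2 ^ (m + 1)) +
        algebraMap k⟦X⟧ L (x - (f i).1) - (y ^ p - (f i).2 ^ p) -
        (y ^ (m + 1) - (f i).2 ^ (m + 1)) := by
    rw [_root_.map_sub]; ring
  rw [key]
  exact sub_mem (sub_mem (add_mem (geSubgroup_mono (by omega) hxi) hxi') h1) (hpow m)

end PowerSeries

section LaurentSeriesExtension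

open AddValuation PowerSeries

variable {k L : Type*} [Field k] [Field L] [Algebra k⟦X⟧ L] {v : AddValuation L (WithTop ℤ)}

theorem exists_const_sub_mem [IsAlgClosed k]
    (hv : ∀ z : L, 0 ≤ v z ↔ z ∈ integralClosure k⟦X⟧ L)
    (hX : algebraMap k⟦X⟧ L X ∈ v.geSubgroup 1) {r : L} (hr : r ∈ v.geSubgroup 0) :
    ∃ c, r - (algebraMap k⟦X⟧ L).comp C c ∈ v.geSubgroup 1 := by
  have hvR : ∀ f : k⟦X⟧, 0 ≤ v (algebraMap k⟦X⟧ L f) := fun f => (hv _).2 (algebraMap_mem _ f)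
  obtain ⟨P, hP, hPr⟩ := (hv r).1 (mem_geSubgroup_zero.1 hr)
  set φ := (algebraMap k⟦X⟧ L).comp C with hφ
  have hcoeff (f : k⟦X⟧) :
      algebraMap k⟦X⟧ L f - φ (constantCoeff f) ∈ v.geSubgroup 1 := by
    rw [hφ, RingHom.comp_apply, ← _root_.map_sub]
    apply algebraMap_mem_geSubgroup_of_mem_span_pow hvR hX
    rw [pow_one, Ideal.mem_span_singleton, X_dvd_iff]
    simp
  have hsum : Polynomial.eval₂ φ r (P.map constantCoeff) ∈ v.geSubgroup 1 := by
    rw [Polynomial.eval₂_map]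
    have : Polynomial.eval₂ (φ.comp constantCoeff) r P =
        -∑ i ∈ P.support,
          (algebraMap k⟦X⟧ L (P.coeff i) - φ (constantCoeff (P.coeff i))) * r ^ i := by
      rw [Polynomial.eval₂_eq_sum, Polynomial.sum] at hPr ⊢
      simp only [sub_mul, Finset.sum_sub_distrib, hPr, zero_sub, neg_neg]
      rfl
    rw [this]
    refine neg_mem (sum_mem fun i _ => ?_)
    simpa using mul_mem_geSubgroup (hcoeff (P.coeff i)) (pow_mem_geSubgroup hr i)
  by_contra! hno
  have hunit (c : k) : v (r - φ c) = 0 := by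
    have hc : r - φ c ∈ v.geSubgroup 0 := sub_mem hr (mem_geSubgroup_zero.2 (hvR (C c)))
    simpa using eq_coe_of_mem_of_notMem hc (hno c)
  have hsplit := IsAlgClosed.splits (P.map (constantCoeff (R := k)))
  rw [hsplit.eq_prod_roots_of_monic (hP.map _), Polynomial.eval₂_multiset_prod,
    Multiset.map_map] at hsum
  have hzero (s : Multiset k) :
      v (s.map (fun c => Polynomial.eval₂ φ r (Polynomial.X - Polynomial.C c))).prod = 0 := by
    induction s using Multiset.induction_on with
    | empty => simp
    | cons a s ih =>
      rw [Multiset.map_cons, Multiset.prod_cons, AddValuation.map_mul, ih]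
      simp [hunit]
  exact notMem_of_map_eq (n := 0) (by simpa using! hzero _) one_pos hsum

theorem exists_map_X_eq [Algebra (LaurentSeries k) L]
    [IsScalarTower k⟦X⟧ (LaurentSeries k) L]
    (hv : ∀ z : L, 0 ≤ v z ↔ z ∈ integralClosure k⟦X⟧ L) :
    ∃ e : ℕ, 0 < e ∧ v (algebraMap k⟦X⟧ L X) = ((e : ℤ) : WithTop ℤ) := by
  have hvR : ∀ f : k⟦X⟧, 0 ≤ v (algebraMap k⟦X⟧ L f) := fun f => (hv _).2 (algebraMap_mem _ f)
  have hinj : Function.Injective (algebraMap k⟦X⟧ L) := by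
    rw [IsScalarTower.algebraMap_eq k⟦X⟧ (LaurentSeries k) L]
    exact (algebraMap (LaurentSeries k) L).injective.comp
      (IsFractionRing.injective k⟦X⟧ (LaurentSeries k))
  have hX0 : algebraMap k⟦X⟧ L X ≠ 0 := (map_ne_zero_iff _ hinj).2 X_ne_zero
  have hX := hvR X
  have hne : v (algebraMap k⟦X⟧ L X) ≠ 0 := by
    intro h
    have hint : (algebraMap k⟦X⟧ L X)⁻¹ ∈ integralClosure k⟦X⟧ L := by
      rw [← hv]
      have h2 : v (algebraMap k⟦X⟧ L X) + v (algebraMap k⟦X⟧ L X)⁻¹ = 0 := by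
        rw [← AddValuation.map_mul, mul_inv_cancel₀ hX0, AddValuation.map_one]
      rw [h, zero_add] at h2
      exact h2.ge
    rw [IsScalarTower.algebraMap_apply k⟦X⟧ (LaurentSeries k) L, ← map_inv₀,
      mem_integralClosure_iff, isIntegral_algebraMap_iff
        (algebraMap (LaurentSeries k) L).injective,
      IsIntegrallyClosed.isIntegral_iff] at hint
    obtain ⟨g, hg⟩ := hint
    have : algebraMap k⟦X⟧ (LaurentSeries k) (X * g) = 1 := by
      rw [_root_.map_mul, hg, mul_inv_cancel₀]
      exact (map_ne_zero_iff _ (IsFractionRing.injective k⟦X⟧ (LaurentSeries k))).2 X_ne_zero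
    rw [← _root_.map_one (algebraMap k⟦X⟧ (LaurentSeries k))] at this
    have := IsFractionRing.injective k⟦X⟧ (LaurentSeries k) this
    exact X_irreducible.not_isUnit (IsUnit.of_mul_eq_one _ this)
  cases hq : v (algebraMap k⟦X⟧ L X) with
  | top => exact absurd (v.top_iff.1 hq) hX0
  | coe q =>
    rw [hq] at hX hne
    norm_cast at hX hne
    exact ⟨q.toNat, by omega, by rw [Int.toNat_of_nonneg hX]⟩

theorem mem_smul_top_of_mem (hv : ∀ z : L, 0 ≤ v z ↔ z ∈ integralClosure k⟦X⟧ L) {e : ℕ}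
    (he : v (algebraMap k⟦X⟧ L X) = ((e : ℤ) : WithTop ℤ)) {i : ℕ}
    (r : integralClosure k⟦X⟧ L) (hr : (r : L) ∈ v.geSubgroup (e * i)) :
    r ∈ (Ideal.span {(X : k⟦X⟧)} ^ i • ⊤ : Submodule k⟦X⟧ (integralClosure k⟦X⟧ L)) := by
  have hX0 : algebraMap k⟦X⟧ L X ≠ 0 := by
    rw [← v.ne_top_iff, he]
    exact WithTop.coe_ne_top
  have hpow := map_pow_eq he i
  have hq : v (r / algebraMap k⟦X⟧ L X ^ i : L) + v (algebraMap k⟦X⟧ L X ^ i) = v (r : L) := by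
    rw [← AddValuation.map_mul]
    congr 1
    field_simp
  have h0 : 0 ≤ v (r / algebraMap k⟦X⟧ L X ^ i : L) := by
    rw [mem_geSubgroup, ← hq, hpow] at hr
    cases hs : v (r / algebraMap k⟦X⟧ L X ^ i : L) with
    | top => simp
    | coe q => rw [hs] at hr; norm_cast at hr ⊢; omega
  have : r = (X ^ i : k⟦X⟧) •
      (⟨r / algebraMap k⟦X⟧ L X ^ i, (hv _).1 h0⟩ : integralClosure k⟦X⟧ L) := by
    ext
    rw [Subalgebra.coe_smul, Algebra.smul_def, _root_.map_pow]
    field_simp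
  rw [this]
  exact Submodule.smul_mem_smul (Ideal.pow_mem_pow (Ideal.mem_span_singleton_self _) i) trivial

theorem mem_of_mem_smul_top (hv : ∀ z : L, 0 ≤ v z ↔ z ∈ integralClosure k⟦X⟧ L) {e : ℕ}
    (he : v (algebraMap k⟦X⟧ L X) = ((e : ℤ) : WithTop ℤ)) {i : ℕ} {r : integralClosure k⟦X⟧ L}
    (hr : r ∈ (Ideal.span {(X : k⟦X⟧)} ^ i • ⊤ : Submodule k⟦X⟧ (integralClosure k⟦X⟧ L))) :
    (r : L) ∈ v.geSubgroup (e * i) := by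
  rw [Ideal.span_singleton_pow, Submodule.ideal_span_singleton_smul] at hr
  obtain ⟨s, -, rfl⟩ := hr
  have hs := mem_geSubgroup_zero.2 ((hv s).2 s.2)
  have := mul_mem_geSubgroup (pow_mem_geSubgroup (mem_geSubgroup.2 he.ge) i) hs
  rw [← _root_.map_pow, ← Algebra.smul_def] at this
  exact this

theorem exists_limit_of_sub_mem_geSubgroup [Module.Finite k⟦X⟧ (integralClosure k⟦X⟧ L)]
    (hv : ∀ z : L, 0 ≤ v z ↔ z ∈ integralClosure k⟦X⟧ L) {e : ℕ} (he0 : 0 < e)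
    (he : v (algebraMap k⟦X⟧ L X) = ((e : ℤ) : WithTop ℤ)) (f : ℕ → L) (hf : ∀ i, 0 ≤ v (f i))
    (hc : ∀ i, f (i + 1) - f i ∈ v.geSubgroup i) : ∃ a, ∀ i, a - f i ∈ v.geSubgroup i := by
  have hc' {i j : ℕ} (hij : i ≤ j) : f j - f i ∈ v.geSubgroup i := by
    induction j, hij using Nat.le_induction with
    | base => simp
    | succ j hij ih =>
      rw [← sub_add_sub_cancel _ (f j)]
      exact add_mem (geSubgroup_mono hij (hc j)) ih
  have : IsPrecomplete (Ideal.span {(X : k⟦X⟧)}) (integralClosure k⟦X⟧ L) :=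
    IsPrecomplete.of_moduleFinite _
  obtain ⟨a, ha⟩ := IsPrecomplete.exists_limit (Ideal.span {(X : k⟦X⟧)})
    (fun i => (⟨f (e * i), (hv _).1 (hf _)⟩ : integralClosure k⟦X⟧ L))
    (fun i => mem_smul_top_of_mem hv he _ (hc' (Nat.mul_le_mul_left e (Nat.le_succ i))))
  refine ⟨a, fun i => ?_⟩
  rw [← sub_add_sub_cancel _ (f (e * i))]
  have hle : i ≤ e * i := Nat.le_mul_of_pos_left i he0
  exact add_mem (geSubgroup_mono hle (mem_of_mem_smul_top hv he (ha i))) (hc' hle)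

theorem linearIndependent_uniformizer_pow
    (hv : ∀ f : k⟦X⟧, 0 ≤ v (algebraMap k⟦X⟧ L f)) {e : ℕ}
    (he : v (algebraMap k⟦X⟧ L X) = ((e : ℤ) : WithTop ℤ)) {z : L} (hz : v z = 1) :
    LinearIndependent k⟦X⟧ (fun i : Fin e => z ^ (i : ℕ)) := by
  classical
  rw [Fintype.linearIndependent_iff]
  intro g hg
  by_contra! hne
  have hval (i : Fin e) (hi : g i ≠ 0) :
      ∃ m : ℕ, v (g i • z ^ (i : ℕ)) = (((e * m + i : ℕ) : ℤ) : WithTop ℤ) := by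
    obtain ⟨m, u, -, hm⟩ := exists_map_algebraMap_eq hv he hi
    refine ⟨m, ?_⟩
    rw [Algebra.smul_def, AddValuation.map_mul, hm,
      map_pow_eq (m := 1) (by simpa using hz) (i : ℕ)]
    norm_cast
    simp
  obtain ⟨i₀, hi₀⟩ := hne
  obtain ⟨i, hi, hmin⟩ := Finset.exists_min_image (Finset.univ.filter fun i => g i ≠ 0)
    (fun i => v (g i • z ^ (i : ℕ))) ⟨i₀, by simpa using hi₀⟩
  simp only [Finset.mem_filter, Finset.mem_univ, true_and] at hi hmin
  obtain ⟨m, hm⟩ := hval i hi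
  have hlt : ∀ j ≠ i, g j • z ^ (j : ℕ) ∈ v.geSubgroup (e * m + i + 1) := by
    intro j hj
    by_cases hgj : g j = 0
    · rw [hgj, zero_smul]; exact zero_mem _
    · obtain ⟨m', hm'⟩ := hval j hgj
      have hle := hmin j hgj
      rw [mem_geSubgroup, hm']
      rw [hm, hm'] at hle
      norm_cast at hle ⊢
      have hmod : e * m + (i : ℕ) ≠ e * m' + j := by
        intro h
        have := congrArg (· % e) h
        simp only [Nat.mul_add_mod, Nat.mod_eq_of_lt i.2, Nat.mod_eq_of_lt j.2] at this
        exact hj (Fin.ext this.symm)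
      omega
  rw [← Finset.add_sum_erase _ _ (Finset.mem_univ i), add_eq_zero_iff_eq_neg] at hg
  refine notMem_of_map_eq hm (Nat.lt_succ_self _) ?_
  rw [hg]
  exact neg_mem (sum_mem fun j hj => hlt j (Finset.ne_of_mem_erase hj))

/-- With algebraically closed residue field, the ramification index is the degree. -/
theorem finrank_integralClosure_eq [Module.Finite k⟦X⟧ (integralClosure k⟦X⟧ L)]
    (hv : ∀ z : L, 0 ≤ v z ↔ z ∈ integralClosure k⟦X⟧ L) {e : ℕ}
    (he : v (algebraMap k⟦X⟧ L X) = ((e : ℤ) : WithTop ℤ))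
    (hres : ∀ r ∈ v.geSubgroup 0, ∃ c, r - (algebraMap k⟦X⟧ L).comp C c ∈ v.geSubgroup 1)
    {z : L} (hz : v z = 1) : Module.finrank k⟦X⟧ (integralClosure k⟦X⟧ L) = e := by
  have hvR : ∀ f : k⟦X⟧, 0 ≤ v (algebraMap k⟦X⟧ L f) := fun f => (hv _).2 (algebraMap_mem _ f)
  let u : integralClosure k⟦X⟧ L := ⟨z, (hv z).1 (by rw [hz]; exact zero_le_one)⟩
  have hli : LinearIndependent k⟦X⟧ (fun i : Fin e => u ^ (i : ℕ)) := by
    apply LinearIndependent.of_comp (integralClosure k⟦X⟧ L).val.toLinearMap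
    exact linearIndependent_uniformizer_pow hvR he hz
  have hspan : ⊤ ≤ Submodule.span k⟦X⟧ (Set.range fun i : Fin e => u ^ (i : ℕ)) := by
    refine Submodule.le_of_le_smul_of_le_jacobson_bot Module.Finite.fg_top
      (IsAdicComplete.le_jacobson_bot (Ideal.span {(X : k⟦X⟧)})) fun r _ => ?_
    obtain ⟨c, hc⟩ := exists_sum_sub_mem hres hz (mem_geSubgroup_zero.2 ((hv r).2 r.2)) e
    have hsum : ∑ i ∈ Finset.range e, (C (c i) : k⟦X⟧) • u ^ i ∈
        Submodule.span k⟦X⟧ (Set.range fun i : Fin e => u ^ (i : ℕ)) :=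
      sum_mem fun i hi => Submodule.smul_mem _ _
        (Submodule.subset_span ⟨⟨i, Finset.mem_range.1 hi⟩, rfl⟩)
    rw [← add_sub_cancel (∑ i ∈ Finset.range e, (C (c i) : k⟦X⟧) • u ^ i) r]
    refine Submodule.add_mem_sup hsum ?_
    have := mem_smul_top_of_mem hv he (i := 1)
      (r - ∑ i ∈ Finset.range e, (C (c i) : k⟦X⟧) • u ^ i) (by
        rw [mul_one]
        convert hc
        simp [u, Algebra.smul_def])
    rwa [pow_one] at this
  rw [Module.finrank_eq_card_basis (Module.Basis.mk hli hspan), Fintype.card_fin]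

/-- In a separable extension, the variable is not a limit of `p`-th powers. -/
theorem not_forall_exists_sub_pow_mem [Algebra (LaurentSeries k) L]
    [IsScalarTower k⟦X⟧ (LaurentSeries k) L] [Algebra.IsSeparable (LaurentSeries k) L]
    {p : ℕ} [Fact p.Prime] [CharP k p] [CharP L p] {x : k⟦X⟧} (hx : Irreducible x)
    (hlim : ∀ f : ℕ → L, (∀ i, 0 ≤ v (f i)) → (∀ i, f (i + 1) - f i ∈ v.geSubgroup i) →
      ∃ a, ∀ i, a - f i ∈ v.geSubgroup i) :
    ¬ ∀ N, ∃ z, v z = 1 ∧ algebraMap k⟦X⟧ L x - z ^ p ∈ v.geSubgroup N := by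
  intro h
  have hp := (Fact.out : p.Prime).pos
  choose z hz hzx using h
  obtain ⟨a, ha⟩ := hlim (fun i => z (i * p)) (fun i => by rw [hz]; exact zero_le_one) (fun i => by
    refine mem_of_pow_mem hp ?_
    rw [sub_pow_char, ← sub_sub_sub_cancel_left _ _ (algebraMap k⟦X⟧ L x)]
    exact sub_mem (hzx _) (geSubgroup_mono (Nat.mul_le_mul_right p (Nat.le_succ i)) (hzx _)))
  have hax : algebraMap k⟦X⟧ L x = a ^ p := by
    rw [← sub_eq_zero]
    refine eq_zero_of_forall_mem (v := v) fun i => ?_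
    rw [← sub_sub_sub_cancel_right _ _ (z (i * p) ^ p), ← sub_pow_char]
    have hi : i ≤ i * p := Nat.le_mul_of_pos_right i hp
    exact geSubgroup_mono hi (sub_mem (hzx _) (pow_mem_geSubgroup (ha i) p))
  have hmem : a ∈ perfectClosure (LaurentSeries k) L := by
    have : CharP (LaurentSeries k) p :=
      (algebraMap (LaurentSeries k) L).charP (algebraMap (LaurentSeries k) L).injective p
    have : ExpChar (LaurentSeries k) p := ExpChar.prime Fact.out
    rw [mem_perfectClosure_iff_pow_mem p]
    refine ⟨1, algebraMap k⟦X⟧ (LaurentSeries k) x, ?_⟩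
    rw [← IsScalarTower.algebraMap_apply, hax, pow_one]
  rw [perfectClosure.eq_bot_of_isSeparable, IntermediateField.mem_bot] at hmem
  obtain ⟨b, rfl⟩ := hmem
  rw [IsScalarTower.algebraMap_apply k⟦X⟧ (LaurentSeries k) L, ← _root_.map_pow] at hax
  have hb := (algebraMap (LaurentSeries k) L).injective hax
  have hbint : IsIntegral k⟦X⟧ b := IsIntegral.of_pow hp (hb ▸ isIntegral_algebraMap)
  rw [IsIntegrallyClosed.isIntegral_iff] at hbint
  obtain ⟨c, rfl⟩ := hbint
  rw [← _root_.map_pow] at hb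
  rw [IsFractionRing.injective k⟦X⟧ (LaurentSeries k) hb] at hx
  exact not_irreducible_pow (Fact.out : p.Prime).ne_one hx

end LaurentSeriesExtension

/-- Let `k` be an algebraically closed field of characteristic `p > 0`,
`K = k((t))`, and `L/K` a separable extension of degree `p`. Here `O_L` is the integral closure
of `k[[t]]` in `L` and `v` is the normalized valuation of `L` (characterized by having `O_L` as
its valuation ring and value group `ℤ`). Then there exist a uniformizer `x` of `K`
(`ord x = 1`), an element `y ∈ O_L` with `v(y) = 1`, and `n > p` with `gcd(n, p) = 1`, such that
`y^p + y^n = x` in `L`. -/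
theorem stmt_0 {k : Type*} [Field k] [IsAlgClosed k] (p : ℕ) [Fact p.Prime] [CharP k p]
    (L : Type*) [Field L] [Algebra (LaurentSeries k) L] [Algebra (PowerSeries k) L]
    [IsScalarTower (PowerSeries k) (LaurentSeries k) L]
    (hdeg : Module.finrank (LaurentSeries k) L = p)
    [Algebra.IsSeparable (LaurentSeries k) L]
    (v : AddValuation L (WithTop ℤ))
    (hv : ∀ z : L, 0 ≤ v z ↔ z ∈ integralClosure (PowerSeries k) L)
    (hv1 : ∃ π : L, v π = 1) :
    ∃ x : LaurentSeries k, x.order = 1 ∧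
      ∃ y : L, y ∈ integralClosure (PowerSeries k) L ∧ v y = 1 ∧
        ∃ n : ℕ, p < n ∧ Nat.Coprime n p ∧
          y ^ p + y ^ n = algebraMap (LaurentSeries k) L x := by
  have hp := (Fact.out : p.Prime).pos
  have : FiniteDimensional (LaurentSeries k) L := FiniteDimensional.of_finrank_pos (hdeg ▸ hp)
  have hfin : Module.Finite (PowerSeries k) (integralClosure (PowerSeries k) L) :=
    IsIntegralClosure.finite (PowerSeries k) (LaurentSeries k) L _
  have hvR : ∀ f : PowerSeries k, 0 ≤ v (algebraMap (PowerSeries k) L f) :=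
    fun f => (hv _).2 (algebraMap_mem _ f)
  have hinj : Function.Injective (algebraMap (PowerSeries k) L) := by
    rw [IsScalarTower.algebraMap_eq (PowerSeries k) (LaurentSeries k) L]
    exact (algebraMap (LaurentSeries k) L).injective.comp
      (IsFractionRing.injective (PowerSeries k) (LaurentSeries k))
  have : CharP L p := charP_of_injective_ringHom
    ((algebraMap (PowerSeries k) L).comp PowerSeries.C).injective p
  obtain ⟨e, he0, he⟩ := exists_map_X_eq hv
  have hX : algebraMap (PowerSeries k) L PowerSeries.X ∈ v.geSubgroup 1 :=
    AddValuation.geSubgroup_mono he0 (AddValuation.mem_geSubgroup.2 he.ge)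
  have hres : ∀ r ∈ v.geSubgroup 0,
      ∃ c, r - (algebraMap (PowerSeries k) L).comp PowerSeries.C c ∈ v.geSubgroup 1 :=
    fun r hr => exists_const_sub_mem hv hX hr
  have hlim := exists_limit_of_sub_mem_geSubgroup hv he0 he
  obtain rfl : e = p := by
    obtain ⟨π, hπ⟩ := hv1
    have : Module.IsTorsionFree (PowerSeries k) L :=
      Module.isTorsionFree_iff_algebraMap_injective.2 hinj
    rw [← finrank_integralClosure_eq hv he hres hπ, ← hdeg]
    exact IsIntegralClosure.rank (PowerSeries k) (LaurentSeries k) L _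
  obtain ⟨c, z, n, hz, hpn, hdvd, h⟩ := AddValuation.exists_pow_add_pow_approx
    (fun c => AddValuation.mem_geSubgroup_zero.2 (hvR _)) hres hv1 he
    (not_forall_exists_sub_pow_mem PowerSeries.X_irreducible hlim)
  rw [RingHom.comp_apply, ← map_mul] at h
  obtain ⟨x, y, hy, hxy⟩ := PowerSeries.exists_pow_add_pow_eq hvR hX hres hlim hpn
    (by rwa [Ne, CharP.cast_eq_zero_iff k e]) hz h
  have hy' : v y = (((1 : ℕ) : ℤ) : WithTop ℤ) := by simpa using hy
  have hvx : v (algebraMap (PowerSeries k) L x) = ((e : ℤ) : WithTop ℤ) := by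
    rw [← hxy]
    refine AddValuation.map_eq_of_sub_mem (x := y ^ e)
      (by rw [AddValuation.map_pow_eq hy' e, one_mul]) ?_
    rw [add_sub_cancel_left]
    exact AddValuation.geSubgroup_mono (by omega)
      (AddValuation.pow_mem_geSubgroup (AddValuation.mem_geSubgroup.2 hy'.ge) n)
  obtain ⟨m, u, rfl, hm⟩ := PowerSeries.exists_map_algebraMap_eq hvR he
    (f := x) (by rintro rfl; simp at hvx)
  obtain rfl : m = 1 := by
    rw [hvx] at hm
    norm_cast at hm
    exact (Nat.mul_eq_left he0.ne').1 hm.symm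
  rw [pow_one] at hxy
  refine ⟨((u : PowerSeries k) * PowerSeries.X : PowerSeries k),
    PowerSeries.order_coe_unit_mul_X u, y, (hv y).1 (by rw [hy]; exact zero_le_one), hy, n, hpn,
    ((Nat.Prime.coprime_iff_not_dvd Fact.out).2 hdvd).symm, ?_⟩
  rw [hxy, IsScalarTower.algebraMap_apply (PowerSeries k) (LaurentSeries k) L]
  rfl
end

section
/- Let K be a field equipped with a multiplicative nonarchimedean absolute value |·| : K → Γ₀ taking values in a linearly ordered commutative group with zero, and let p be a prime number. Then for all a, b ∈ K one has |(a + b)^p − a^p − b^p| ≤ |p| · max(|a|, |b|)^p, where |p| denotes the absolute value of the image of p in K. -/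
/-- A valuation is at most `1` on natural numbers. -/
lemma Valuation.map_natCast_le_one {R : Type*} [Ring R] {Γ₀ : Type*}
    [LinearOrderedCommGroupWithZero Γ₀] (v : Valuation R Γ₀) (n : ℕ) : v (n : R) ≤ 1 := by
  induction n with
  | zero => simp
  | succ n ih =>
    rw [Nat.cast_succ]
    exact v.map_add_le ih v.map_one.le

/-- For a field `K` with a multiplicative nonarchimedean absolute value
`|·| : K → Γ₀` (a `Valuation`) and a prime `p`, for all `a b : K` one has
`|(a + b)^p − a^p − b^p| ≤ |p| · max(|a|, |b|)^p`. -/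
theorem stmt_8 {K : Type*} [Field K] {Γ₀ : Type*} [LinearOrderedCommGroupWithZero Γ₀]
    (v : Valuation K Γ₀) (p : ℕ) (hp : p.Prime) (a b : K) :
    v ((a + b) ^ p - a ^ p - b ^ p) ≤ v (p : K) * max (v a) (v b) ^ p := by
  have hsub : (a + b) ^ p - a ^ p - b ^ p =
      p * ∑ k ∈ Finset.Ioo 0 p, a ^ k * b ^ (p - k) * ↑(p.choose k / p) := by
    rw [add_pow_prime_eq' hp]
    ring
  rw [hsub, v.map_mul]
  refine mul_le_mul_right (v.map_sum_le fun k hk ↦ ?_) _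
  have hkp : k ≤ p := (Finset.mem_Ioo.mp hk).2.le
  calc v (a ^ k * b ^ (p - k) * ↑(p.choose k / p))
      = v a ^ k * v b ^ (p - k) * v ((p.choose k / p : ℕ) : K) := by simp only [map_mul, map_pow]
    _ ≤ max (v a) (v b) ^ k * max (v a) (v b) ^ (p - k) * 1 := by
        gcongr
        · exact le_max_left _ _
        · exact le_max_right _ _
        · exact v.map_natCast_le_one _
    _ = max (v a) (v b) ^ p := by rw [mul_one, ← pow_add, Nat.add_sub_cancel' hkp]
end

section
/- Let A be a commutative ring equipped with a complete nonarchimedean ring norm. Let u ∈ A be a unit with ‖u‖·‖u⁻¹‖ = 1 and let z ∈ A with ‖z‖ < ‖u‖. Then u + z is a unit of A, and for every integer i ∈ ℤ there exists Q ∈ A with (u + z)^i − u^i = u^{i−1}·z·Q and ‖Q‖ ≤ 1. -/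
/-- In a nonarchimedean normed ring, the inverse of a unit `1 + t` with `‖t‖ < 1` has norm at
most `1`. -/
theorem IsNonarchimedean.norm_inv_le_one_of_eq_one_add {A : Type*} [NormedCommRing A]
    [NormOneClass A] (hna : IsNonarchimedean (fun a : A => ‖a‖)) {t : A} (ht : ‖t‖ < 1)
    {v : Aˣ} (hv : (v : A) = 1 + t) : ‖((v⁻¹ : Aˣ) : A)‖ ≤ 1 := by
  have hinv : ((v⁻¹ : Aˣ) : A) = 1 + -(t * ((v⁻¹ : Aˣ) : A)) := by
    have h := v.mul_inv
    rw [hv] at h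
    linear_combination h
  by_contra! hlt
  have hmax : ‖((v⁻¹ : Aˣ) : A)‖ ≤ max 1 ‖t * ((v⁻¹ : Aˣ) : A)‖ := by
    have h := hna 1 (-(t * ((v⁻¹ : Aˣ) : A)))
    simp only [norm_one, norm_neg] at h
    rwa [← hinv] at h
  have hmul := norm_mul_le t ((v⁻¹ : Aˣ) : A)
  rcases le_max_iff.mp hmax with h | h <;> nlinarith

/-- In a nonarchimedean normed ring, if `v = 1 + t` is a unit with `‖t‖ < 1`, then every integer
power of `v` differs from `1` by `t` times an element of norm at most `1`. -/
theorem IsNonarchimedean.exists_zpow_sub_one_eq_mul {A : Type*} [NormedCommRing A]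
    [NormOneClass A] (hna : IsNonarchimedean (fun a : A => ‖a‖)) {t : A} (ht : ‖t‖ < 1)
    {v : Aˣ} (hv : (v : A) = 1 + t) (i : ℤ) :
    ∃ Q : A, ((v ^ i : Aˣ) : A) - 1 = t * Q ∧ ‖Q‖ ≤ 1 := by
  have hv_le : ‖(v : A)‖ ≤ 1 := by
    rw [hv]
    exact (hna 1 t).trans (max_le norm_one.le ht.le)
  have hinv_le := hna.norm_inv_le_one_of_eq_one_add ht hv
  induction i with
  | zero => exact ⟨0, by simp, by simp⟩
  | succ n ih =>
    obtain ⟨Q, hQ, hQ_le⟩ := ih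
    refine ⟨v * Q + 1, ?_, (hna _ _).trans (max_le ?_ norm_one.le)⟩
    · rw [zpow_add_one, Units.val_mul]
      linear_combination (v : A) * hQ + hv
    · exact (norm_mul_le _ _).trans (mul_le_one₀ hv_le (norm_nonneg _) hQ_le)
  | pred n ih =>
    obtain ⟨Q, hQ, hQ_le⟩ := ih
    refine ⟨((v⁻¹ : Aˣ) : A) * Q + -((v⁻¹ : Aˣ) : A), ?_, (hna _ _).trans (max_le ?_ ?_)⟩
    · rw [zpow_sub_one, Units.val_mul]
      linear_combination ((v⁻¹ : Aˣ) : A) * hQ - ((v⁻¹ : Aˣ) : A) * hv + v.mul_inv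
    · exact (norm_mul_le _ _).trans (mul_le_one₀ hinv_le (norm_nonneg _) hQ_le)
    · simpa using hinv_le

/-- Let `A` be a commutative ring with a complete nonarchimedean ring norm.
If `u ∈ A` is a unit with `‖u‖·‖u⁻¹‖ = 1` and `z ∈ A` satisfies `‖z‖ < ‖u‖`, then `u + z` is a
unit of `A`, and for every `i ∈ ℤ` there is `Q ∈ A` with
`(u + z)^i − u^i = u^{i−1}·z·Q` and `‖Q‖ ≤ 1`. -/
theorem stmt_10 {A : Type*} [NormedCommRing A] [NormOneClass A] [CompleteSpace A]
    (hna : IsNonarchimedean (fun a : A => ‖a‖))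
    (u : Aˣ) (hu : ‖(u : A)‖ * ‖((u⁻¹ : Aˣ) : A)‖ = 1)
    (z : A) (hz : ‖z‖ < ‖(u : A)‖) :
    IsUnit ((u : A) + z) ∧
    ∃ w : Aˣ, (w : A) = (u : A) + z ∧
      ∀ i : ℤ, ∃ Q : A,
        ((w ^ i : Aˣ) : A) - ((u ^ i : Aˣ) : A) = ((u ^ (i - 1) : Aˣ) : A) * z * Q ∧ ‖Q‖ ≤ 1 := by
  have ht : ‖((u⁻¹ : Aˣ) : A) * z‖ < 1 := by
    have hpos : 0 < ‖((u⁻¹ : Aˣ) : A)‖ := by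
      refine (norm_nonneg _).lt_of_ne fun h => ?_
      simp [← h] at hu
    have hmul := norm_mul_le ((u⁻¹ : Aˣ) : A) z
    nlinarith
  obtain ⟨v, hv⟩ : ∃ v : Aˣ, (v : A) = 1 + ((u⁻¹ : Aˣ) : A) * z :=
    ⟨Units.oneSub (-(((u⁻¹ : Aˣ) : A) * z)) (by rwa [norm_neg]), by simp⟩
  have hw : ((u * v : Aˣ) : A) = (u : A) + z := by
    rw [Units.val_mul, hv, mul_add, mul_one, Units.mul_inv_cancel_left]
  refine ⟨⟨u * v, hw⟩, u * v, hw, fun i => ?_⟩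
  obtain ⟨Q, hQ, hQ_le⟩ := hna.exists_zpow_sub_one_eq_mul ht hv i
  refine ⟨Q, ?_, hQ_le⟩
  rw [mul_zpow, zpow_sub_one, Units.val_mul, Units.val_mul]
  linear_combination ((u ^ i : Aˣ) : A) * hQ
end

section
/- Let p be a prime number and n a positive integer with p ∤ n. Then for every i ∈ ℕ, the generalized binomial coefficient C(1/n, i) := (1/i!)·∏_{j=0}^{i−1}(1/n − j) ∈ ℚ has p-adic absolute value at most 1 (i.e. lies in ℤ_(p) ⊂ ℚ); moreover, the formal power series B(T) = Σ_{i ≥ 0} C(1/n, i)·T^i ∈ ℚ[[T]] satisfies B(T)^n = 1 + T. -/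
/-- The generalized binomial coefficient `C(q, i) = q(q − 1)⋯(q − i + 1)/i!` for `q : ℚ`. -/
noncomputable def ratChoose (q : ℚ) (i : ℕ) : ℚ :=
  (∏ j ∈ Finset.range i, (q - (j : ℚ))) / (i.factorial : ℚ)

theorem ratChoose_eq_ringChoose (q : ℚ) (i : ℕ) : ratChoose q i = Ring.choose q i := by
  rw [Ring.choose_eq_smul, ← Polynomial.eval₂_smulOneHom_eq_smeval, ← Polynomial.eval_map,
    Subsingleton.elim (RingHom.smulOneHom : ℤ →+* ℚ) (Int.castRingHom ℚ), descPochhammer_map,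
    descPochhammer_eval_eq_prod_range, ratChoose, smul_eq_mul, div_eq_inv_mul]

theorem norm_ratChoose_le_one {p : ℕ} [Fact p.Prime] {q : ℚ} (hq : ‖(q : ℚ_[p])‖ ≤ 1) (i : ℕ) :
    ‖(ratChoose q i : ℚ_[p])‖ ≤ 1 := by
  have h : (ratChoose q i : ℚ_[p]) = (Ring.choose (⟨q, hq⟩ : ℤ_[p]) i : ℤ_[p]) := by
    rw [ratChoose_eq_ringChoose]
    exact (Ring.map_choose (Rat.castHom ℚ_[p]) q i).trans
      (Ring.map_choose (PadicInt.Coe.ringHom (p := p)) ⟨q, hq⟩ i).symm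
  rw [h]
  exact PadicInt.norm_le_one _

theorem binomialSeries_nsmul {R A : Type*} [CommRing R] [BinomialRing R] [Ring A] [Algebra R A]
    (m : ℕ) (r : R) :
    PowerSeries.binomialSeries A (m • r) = PowerSeries.binomialSeries A r ^ m := by
  induction m with
  | zero => simp
  | succ m ih => rw [succ_nsmul, PowerSeries.binomialSeries_add, ih, pow_succ]

/-- Let `p` be a prime and `n` a positive integer with `p ∤ n`. Then every
generalized binomial coefficient `C(1/n, i)` has `p`-adic absolute value at most `1`, and the
power series `B(T) = Σ_{i ≥ 0} C(1/n, i)·T^i ∈ ℚ[[T]]` satisfies `B(T)^n = 1 + T`. -/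
theorem stmt_15 (p : ℕ) [hp : Fact p.Prime] (n : ℕ) (hn : 0 < n) (hpn : ¬ p ∣ n) :
    (∀ i : ℕ, ‖((ratChoose (1 / (n : ℚ)) i : ℚ) : ℚ_[p])‖ ≤ 1) ∧
    (PowerSeries.mk fun i => ratChoose (1 / (n : ℚ)) i : PowerSeries ℚ) ^ n
      = 1 + PowerSeries.X := by
  refine ⟨norm_ratChoose_le_one ?_, ?_⟩
  · have hn1 : ‖(n : ℚ_[p])‖ = 1 :=
      Padic.norm_natCast_eq_one_iff.2 ((Nat.Prime.coprime_iff_not_dvd hp.out).2 hpn)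
    simp [hn1]
  · have hB : (PowerSeries.mk fun i => ratChoose (1 / (n : ℚ)) i : PowerSeries ℚ)
        = PowerSeries.binomialSeries ℚ (1 / (n : ℚ)) := by
      ext i
      simp [ratChoose_eq_ringChoose]
    have hn0 : (n : ℚ) ≠ 0 := by exact_mod_cast hn.ne'
    have h1 : n • (1 / (n : ℚ)) = ((1 : ℕ) : ℚ) := by
      rw [nsmul_eq_mul, mul_one_div_cancel hn0, Nat.cast_one]
    rw [hB, ← binomialSeries_nsmul, h1, PowerSeries.binomialSeries_nat, pow_one]
end
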